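/- If every maximal clique C_q of the block-clique graph G(N,E) representing the aggregated sparsity of the data matrices has at most 4 nodes, then the decomposed problems with cones CPP^{C_q} and DNN^{C_q} coincide: they share the same feasible solutions, optimal solutions, and optimal value, so η(CPPⁿ) = η(DNNⁿ). -/

import Mathlib

open Matrix SimpleGraph

def HasChord {V : Type} (G : SimpleGraph V) {v : V} (c : G.Walk v v) : Prop :=
  ∃ x y, x ∈ c.support ∧ y ∈ c.support ∧ G.Adj x y ∧ s(x, y) ∉ c.edges

def IsChordal {V : Type} (G : SimpleGraph V) : Prop :=
  ∀ (v : V) (c : G.Walk v v), c.IsCycle → 4 ≤ c.length → HasChord G c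

def IsMaxClique {V : Type} (G : SimpleGraph V) (s : Set V) : Prop :=
  G.IsClique s ∧ ∀ t : Set V, G.IsClique t → s ⊆ t → t = s

/-- X_C ∈ CPP^C. -/
def IsCPOn {n : ℕ} (X : Matrix (Fin n) (Fin n) ℝ) (C : Set (Fin n)) : Prop :=
  ∃ (m : ℕ) (y : Fin m → Fin n → ℝ), (∀ k i, 0 ≤ y k i) ∧
    ∀ i ∈ C, ∀ j ∈ C, X i j = ∑ k, y k i * y k j

/-- X_C ∈ DNN^C. -/
def IsDNNOn {n : ℕ} (X : Matrix (Fin n) (Fin n) ℝ) (C : Set (Fin n)) : Prop :=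
  (∀ i ∈ C, ∀ j ∈ C, 0 ≤ X i j) ∧
    ∀ x : Fin n → ℝ, (∀ i, i ∉ C → x i = 0) → 0 ≤ x ⬝ᵥ X.mulVec x

/-- A matrix is completely positive if it is a finite sum of matrices `b bᵀ` with `b ≥ 0`. -/
def IsCompletelyPositive {ι : Type*} (A : Matrix ι ι ℝ) : Prop :=
  ∃ (m : ℕ) (y : Fin m → ι → ℝ), (∀ k i, 0 ≤ y k i) ∧ ∀ i j, A i j = ∑ k, y k i * y k j

/-- The number of nonzero entries plus the rank. -/
noncomputable def entriesAddRank {ι : Type*} [Fintype ι] (A : Matrix ι ι ℝ) : ℕ :=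
  {p : ι × ι | A p.1 p.2 ≠ 0}.ncard + A.rank

lemma IsCompletelyPositive.submatrix {ι κ : Type*} {A : Matrix ι ι ℝ}
    (h : IsCompletelyPositive A) (f : κ → ι) : IsCompletelyPositive (A.submatrix f f) := by
  obtain ⟨m, y, hy, hA⟩ := h
  exact ⟨m, fun k i => y k (f i), fun k i => hy k (f i), fun i j => hA (f i) (f j)⟩

lemma isCompletelyPositive_zero {ι : Type*} : IsCompletelyPositive (0 : Matrix ι ι ℝ) :=
  ⟨0, fun _ _ => 0, fun _ _ => le_rfl, fun i j => by simp⟩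

lemma IsCompletelyPositive.of_sub_smul_vecMulVec {ι : Type*} {A : Matrix ι ι ℝ} {t : ℝ}
    {b : ι → ℝ} (ht : 0 ≤ t) (hb : ∀ i, 0 ≤ b i)
    (h : IsCompletelyPositive (A - t • vecMulVec b b)) : IsCompletelyPositive A := by
  obtain ⟨m, y, hy, hA⟩ := h
  refine ⟨m + 1, Fin.cons (fun i => √t * b i) y, fun k i => ?_, fun i j => ?_⟩
  · refine Fin.cases ?_ (fun k => ?_) k
    · exact mul_nonneg (Real.sqrt_nonneg t) (hb i)
    · exact hy k i
  · have := hA i j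
    simp only [Matrix.sub_apply, Matrix.smul_apply, vecMulVec_apply, smul_eq_mul] at this
    simp only [Fin.sum_univ_succ, Fin.cons_zero, Fin.cons_succ, ← this]
    linear_combination (-b i * b j) * Real.mul_self_sqrt ht

lemma dotProduct_mulVec_comm_of_posSemidef {ι : Type*} [Fintype ι] {A : Matrix ι ι ℝ}
    (hA : A.PosSemidef) (x y : ι → ℝ) : x ⬝ᵥ A *ᵥ y = y ⬝ᵥ A *ᵥ x := by
  have h : Aᵀ = A := by simpa [IsHermitian] using hA.1
  rw [dotProduct_mulVec, ← mulVec_transpose, h, dotProduct_comm]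

/-- Subtracting `t b bᵀ` with `b = A x` keeps `A` positive semidefinite for `t ≤ 1 / xᵀ A x`. -/
lemma posSemidef_sub_smul_vecMulVec {ι : Type*} [Fintype ι] {A : Matrix ι ι ℝ}
    (hA : A.PosSemidef) (x : ι → ℝ) (hc : 0 < x ⬝ᵥ A *ᵥ x) {t : ℝ}
    (ht : t * (x ⬝ᵥ A *ᵥ x) ≤ 1) :
    (A - t • vecMulVec (A *ᵥ x) (A *ᵥ x)).PosSemidef := by
  refine PosSemidef.of_dotProduct_mulVec_nonneg ?_ fun y => ?_
  · have h : Aᵀ = A := by simpa [IsHermitian] using hA.1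
    simp [IsHermitian, conjTranspose_eq_transpose_of_trivial, h, transpose_vecMulVec]
  set c := x ⬝ᵥ A *ᵥ x
  set d := y ⬝ᵥ A *ᵥ x
  have hz := hA.dotProduct_mulVec_nonneg (c • y - d • x)
  have hy := hA.dotProduct_mulVec_nonneg y
  have hxy := dotProduct_mulVec_comm_of_posSemidef hA x y
  simp only [star_trivial] at hz hy ⊢
  have e1 : (c • y - d • x) ⬝ᵥ A *ᵥ (c • y - d • x) = c * (c * (y ⬝ᵥ A *ᵥ y) - d ^ 2) := by
    simp only [mulVec_sub, mulVec_smul, sub_dotProduct, dotProduct_sub, smul_dotProduct,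
      dotProduct_smul, smul_eq_mul, hxy]
    ring
  have e2 : y ⬝ᵥ (A - t • vecMulVec (A *ᵥ x) (A *ᵥ x)) *ᵥ y = y ⬝ᵥ A *ᵥ y - t * d ^ 2 := by
    rw [sub_mulVec, dotProduct_sub, smul_mulVec, dotProduct_smul, vecMulVec_mulVec,
      dotProduct_comm (A *ᵥ x) y]
    simp only [op_smul_eq_smul, dotProduct_smul, smul_eq_mul]
    ring
  rw [e1] at hz
  rw [e2]
  have h1 : 0 ≤ c * (y ⬝ᵥ A *ᵥ y) - d ^ 2 := nonneg_of_mul_nonneg_right hz hc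
  rcases le_total t 0 with h | h
  · nlinarith [sq_nonneg d]
  · nlinarith [mul_nonneg h h1]

lemma sub_smul_vecMulVec_eq_mul {ι : Type*} [Fintype ι] [DecidableEq ι] (A : Matrix ι ι ℝ)
    (x b : ι → ℝ) (t : ℝ) :
    A - t • vecMulVec (A *ᵥ x) b = A * (1 - t • vecMulVec x b) := by
  rw [Matrix.mul_sub, Matrix.mul_one, Matrix.mul_smul, mul_vecMulVec]

lemma rank_sub_smul_vecMulVec_lt {ι : Type*} [Fintype ι] {A : Matrix ι ι ℝ}
    (hA : A.PosSemidef) (x : ι → ℝ) (hc : 0 < x ⬝ᵥ A *ᵥ x) :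
    (A - (x ⬝ᵥ A *ᵥ x)⁻¹ • vecMulVec (A *ᵥ x) (A *ᵥ x)).rank < A.rank := by
  classical
  have hpsd := posSemidef_sub_smul_vecMulVec hA x hc (t := (x ⬝ᵥ A *ᵥ x)⁻¹)
    (inv_mul_cancel₀ hc.ne').le
  set A' := A - (x ⬝ᵥ A *ᵥ x)⁻¹ • vecMulVec (A *ᵥ x) (A *ᵥ x) with hA'
  have hx : A' *ᵥ x = 0 := by
    rw [hA', sub_mulVec, smul_mulVec, vecMulVec_mulVec, dotProduct_comm (A *ᵥ x) x,
      op_smul_eq_smul, smul_smul, inv_mul_cancel₀ hc.ne', one_smul, sub_self]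
  refine Submodule.finrank_lt_finrank_of_lt (lt_of_le_of_ne ?_ fun h => ?_)
  · rw [hA', sub_smul_vecMulVec_eq_mul, mulVecLin_mul]
    exact LinearMap.range_comp_le_range _ _
  · have hb : A *ᵥ x ∈ LinearMap.range A'.mulVecLin := by
      rw [h]
      exact ⟨x, rfl⟩
    obtain ⟨z, hz⟩ := hb
    rw [mulVecLin_apply] at hz
    rw [← hz, dotProduct_mulVec_comm_of_posSemidef hpsd, hx, dotProduct_zero] at hc
    exact lt_irrefl _ hc

/-- A nonnegative vector `b = A x` whose support is a clique in the graph of `A` can be split off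
so that the number of nonzero entries or the rank drops. -/
lemma exists_sub_smul_vecMulVec {ι : Type*} [Fintype ι] {A : Matrix ι ι ℝ}
    (hA : A.PosSemidef) (hpos : ∀ i j, 0 ≤ A i j) (x b : ι → ℝ) (hxb : A *ᵥ x = b)
    (hb : ∀ i, 0 ≤ b i) (hb0 : b ≠ 0) (hsupp : ∀ i j, b i ≠ 0 → b j ≠ 0 → A i j ≠ 0) :
    ∃ t : ℝ, 0 ≤ t ∧ (A - t • vecMulVec b b).PosSemidef ∧
      (∀ i j, 0 ≤ (A - t • vecMulVec b b) i j) ∧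
      entriesAddRank (A - t • vecMulVec b b) < entriesAddRank A := by
  classical
  subst hxb
  have hc : 0 < x ⬝ᵥ A *ᵥ x := by
    refine lt_of_le_of_ne (by simpa using hA.dotProduct_mulVec_nonneg x) fun h => hb0 ?_
    exact (hA.dotProduct_mulVec_zero_iff x).1 (by simpa using h.symm)
  set b := A *ᵥ x with hbdef
  set c := x ⬝ᵥ b with hcdef
  have hzero : ∀ t : ℝ, {p : ι × ι | (A - t • vecMulVec b b) p.1 p.2 ≠ 0} ⊆
      {p : ι × ι | A p.1 p.2 ≠ 0} := by
    rintro t ⟨i, j⟩ h h0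
    refine h ?_
    have : b i * b j = 0 := by
      by_contra hne
      exact hsupp i j (left_ne_zero_of_mul hne) (right_ne_zero_of_mul hne) h0
    simp only at h0
    simp [vecMulVec_apply, h0, this]
  obtain ⟨k, hk⟩ := Function.ne_iff.1 hb0
  obtain ⟨p, hp, hmin⟩ := Finset.exists_min_image
    (Finset.univ.filter fun p : ι × ι => b p.1 * b p.2 ≠ 0)
    (fun p => A p.1 p.2 / (b p.1 * b p.2)) ⟨(k, k), by simpa using hk⟩
  simp only [Finset.mem_filter, Finset.mem_univ, true_and] at hp hmin
  have hnonneg : ∀ t, t ≤ A p.1 p.2 / (b p.1 * b p.2) →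
      ∀ i j, 0 ≤ (A - t • vecMulVec b b) i j := by
    intro t ht i j
    simp only [Matrix.sub_apply, Matrix.smul_apply, vecMulVec_apply, smul_eq_mul, sub_nonneg]
    by_cases h : b i * b j = 0
    · simpa [h] using hpos i j
    · have h' : 0 < b i * b j := lt_of_le_of_ne (mul_nonneg (hb i) (hb j)) (Ne.symm h)
      exact (le_div_iff₀ h').1 (ht.trans (hmin (i, j) h))
  rcases le_or_gt c⁻¹ (A p.1 p.2 / (b p.1 * b p.2)) with h | h
  · refine ⟨c⁻¹, (inv_pos.2 hc).le, ?_, hnonneg _ h, ?_⟩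
    · exact posSemidef_sub_smul_vecMulVec hA x hc (inv_mul_cancel₀ hc.ne').le
    · exact add_lt_add_of_le_of_lt (Set.ncard_le_ncard (hzero _) (Set.toFinite _))
        (rank_sub_smul_vecMulVec_lt hA x hc)
  · have ht : 0 ≤ A p.1 p.2 / (b p.1 * b p.2) :=
      div_nonneg (hpos _ _) (mul_nonneg (hb _) (hb _))
    refine ⟨_, ht, ?_, hnonneg _ le_rfl, ?_⟩
    · refine posSemidef_sub_smul_vecMulVec hA x hc ?_
      have := mul_le_mul_of_nonneg_right h.le hc.le
      rwa [inv_mul_cancel₀ hc.ne'] at this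
    · refine add_lt_add_of_lt_of_le (Set.ncard_lt_ncard ?_ (Set.toFinite _)) ?_
      · refine (Set.ssubset_iff_of_subset (hzero _)).2 ⟨p, ?_, ?_⟩
        · exact hsupp _ _ (left_ne_zero_of_mul hp) (right_ne_zero_of_mul hp)
        · simp [vecMulVec_apply, div_mul_cancel₀ _ hp]
      · conv_lhs => rw [hbdef, sub_smul_vecMulVec_eq_mul]
        exact rank_mul_le_left _ _

/-- If `A` has the pattern of a four-cycle and `A w` vanishes after flipping the sign of `w` on
one side of the bipartition, then `A` is the sum of four rank-one edge matrices. -/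
lemma isCompletelyPositive_of_cycle_of_scaling {A : Matrix (Fin 4) (Fin 4) ℝ}
    (hs : ∀ i j, A i j = A j i) (h01 : A 0 1 = 0) (h23 : A 2 3 = 0) (h02 : 0 < A 0 2)
    (h03 : 0 < A 0 3) (h12 : 0 < A 1 2) (h13 : 0 < A 1 3) {w : Fin 4 → ℝ} (hwpos : ∀ i, 0 < w i)
    (e0 : A 0 0 * w 0 = A 0 2 * w 2 + A 0 3 * w 3) (e1 : A 1 1 * w 1 = A 1 2 * w 2 + A 1 3 * w 3)
    (e2 : A 2 2 * w 2 = A 0 2 * w 0 + A 1 2 * w 1) (e3 : A 3 3 * w 3 = A 0 3 * w 0 + A 1 3 * w 1) :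
    IsCompletelyPositive A := by
  obtain ⟨w0, w1, w2, w3⟩ : w 0 ≠ 0 ∧ w 1 ≠ 0 ∧ w 2 ≠ 0 ∧ w 3 ≠ 0 :=
    ⟨(hwpos 0).ne', (hwpos 1).ne', (hwpos 2).ne', (hwpos 3).ne'⟩
  have hq : ∀ i j, 0 < A i j → 0 ≤ A i j / (w i * w j) := fun i j h =>
    (div_pos h (mul_pos (hwpos i) (hwpos j))).le
  refine .of_sub_smul_vecMulVec (b := ![w 2, 0, w 0, 0]) (hq 0 2 h02) ?_ <|
    .of_sub_smul_vecMulVec (b := ![w 3, 0, 0, w 0]) (hq 0 3 h03) ?_ <|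
    .of_sub_smul_vecMulVec (b := ![0, w 2, w 1, 0]) (hq 1 2 h12) ?_ <|
    .of_sub_smul_vecMulVec (b := ![0, w 3, 0, w 1]) (hq 1 3 h13) ?_ ?_
  iterate 4
    intro i
    fin_cases i <;> simp [fun i => (hwpos i).le]
  convert isCompletelyPositive_zero using 1
  ext i j
  fin_cases i <;> fin_cases j <;>
    simp [h01, h23, hs 1 0, hs 2 0, hs 2 1, hs 3 0, hs 3 1, hs 3 2] <;>
    field_simp <;> linarith

lemma isCompletelyPositive_of_cycle {A : Matrix (Fin 4) (Fin 4) ℝ} (hA : A.PosSemidef)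
    (h01 : A 0 1 = 0) (h23 : A 2 3 = 0) (h02 : 0 < A 0 2) (h03 : 0 < A 0 3) (h12 : 0 < A 1 2)
    (h13 : 0 < A 1 3) (hdet : A.det = 0) : IsCompletelyPositive A := by
  have hs : ∀ i j, A i j = A j i := fun i j => by simpa using (hA.1.apply i j).symm
  obtain ⟨x, hx0, hx⟩ := exists_mulVec_eq_zero_iff.2 hdet
  have hw : A *ᵥ ![|x 0|, |x 1|, -|x 2|, -|x 3|] = 0 := by
    refine (hA.dotProduct_mulVec_zero_iff _).1 (le_antisymm ?_ (hA.dotProduct_mulVec_nonneg _))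
    have hxx : x ⬝ᵥ A *ᵥ x = 0 := by rw [hx, dotProduct_zero]
    simp only [star_trivial, dotProduct, mulVec, Fin.sum_univ_four, cons_val, h01, h23, hs 1 0,
      hs 2 0, hs 2 1, hs 3 0, hs 3 1, hs 3 2] at hxx ⊢
    have hoff : ∀ a u v : ℝ, 0 < a → -(a * (|u| * |v|)) ≤ a * (u * v) := fun a u v ha => by
      rw [← abs_mul, ← mul_neg]
      exact mul_le_mul_of_nonneg_left (neg_abs_le _) ha.le
    have hon : ∀ a u : ℝ, a * (|u| * |u|) = a * (u * u) := fun a u => by rw [abs_mul_abs_self]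
    linarith [hoff _ (x 0) (x 2) h02, hoff _ (x 0) (x 3) h03, hoff _ (x 1) (x 2) h12,
      hoff _ (x 1) (x 3) h13, hon (A 0 0) (x 0), hon (A 1 1) (x 1), hon (A 2 2) (x 2),
      hon (A 3 3) (x 3)]
  obtain ⟨w, hwx⟩ : ∃ w : Fin 4 → ℝ, ∀ i, w i = |x i| := ⟨fun i => |x i|, fun _ => rfl⟩
  have hwn : ∀ i, 0 ≤ w i := fun i => by rw [hwx]; exact abs_nonneg _
  have hw0 : ∃ i, w i ≠ 0 := by
    obtain ⟨i, hi⟩ := Function.ne_iff.1 hx0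
    exact ⟨i, by rw [hwx]; exact abs_ne_zero.2 hi⟩
  simp only [← hwx] at hw
  have e0 : A 0 0 * w 0 = A 0 2 * w 2 + A 0 3 * w 3 := by
    have := congrFun hw 0
    simp only [mulVec, dotProduct, Fin.sum_univ_four, cons_val, h01, Pi.zero_apply] at this
    linarith
  have e1 : A 1 1 * w 1 = A 1 2 * w 2 + A 1 3 * w 3 := by
    have := congrFun hw 1
    simp only [mulVec, dotProduct, Fin.sum_univ_four, cons_val, hs 1 0, h01,
      Pi.zero_apply] at this
    linarith
  have e2 : A 2 2 * w 2 = A 0 2 * w 0 + A 1 2 * w 1 := by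
    have := congrFun hw 2
    simp only [mulVec, dotProduct, Fin.sum_univ_four, cons_val, hs 2 0, hs 2 1, h23,
      Pi.zero_apply] at this
    linarith
  have e3 : A 3 3 * w 3 = A 0 3 * w 0 + A 1 3 * w 1 := by
    have := congrFun hw 3
    simp only [mulVec, dotProduct, Fin.sum_univ_four, cons_val, hs 3 0, hs 3 1, hs 3 2, h23,
      Pi.zero_apply] at this
    linarith
  have pair : ∀ a b u v d y : ℝ, 0 < a → 0 < b → 0 ≤ u → 0 ≤ v → d * y = a * u + b * v →
      y = 0 → u = 0 ∧ v = 0 := by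
    intro a b u v d y ha hb hu hv h hy
    rw [hy, mul_zero] at h
    have h1 := mul_nonneg ha.le hu
    have h2 := mul_nonneg hb.le hv
    have h3 : a * u = 0 := by linarith
    have h4 : b * v = 0 := by linarith
    exact ⟨(mul_eq_zero.1 h3).resolve_left ha.ne', (mul_eq_zero.1 h4).resolve_left hb.ne'⟩
  have p0 := pair _ _ _ _ _ _ h02 h03 (hwn 2) (hwn 3) e0
  have p1 := pair _ _ _ _ _ _ h12 h13 (hwn 2) (hwn 3) e1
  have p2 := pair _ _ _ _ _ _ h02 h12 (hwn 0) (hwn 1) e2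
  have p3 := pair _ _ _ _ _ _ h03 h13 (hwn 0) (hwn 1) e3
  have hwpos : ∀ i, 0 < w i := fun i => lt_of_le_of_ne (hwn i) fun h => by
    have h2 : w 2 = 0 := by
      fin_cases i
      exacts [(p0 h.symm).1, (p1 h.symm).1, h.symm, (p0 (p3 h.symm).1).1]
    obtain ⟨j, hj⟩ := hw0
    fin_cases j
    exacts [hj (p2 h2).1, hj (p2 h2).2, hj h2, hj (p0 (p2 h2).1).2]
  exact isCompletelyPositive_of_cycle_of_scaling hs h01 h23 h02 h03 h12 h13 hwpos e0 e1 e2 e3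

/-- A nonempty graph on four vertices, none of which is simplicial, is a cycle; an isolated vertex
without a loop is not regarded as part of the graph. -/
lemma exists_perm_cycle_of_no_simplicial (P : Fin 4 → Fin 4 → Prop)
    (hs : ∀ i j, P i j → P j i) (hd : ∀ i j, P i j → P i i)
    (hn : ∀ k, P k k → ∃ i j, P i k ∧ P j k ∧ ¬P i j) (h0 : ∃ i j, P i j) :
    ∃ σ : Equiv.Perm (Fin 4), ¬P (σ 0) (σ 1) ∧ ¬P (σ 2) (σ 3) ∧ P (σ 0) (σ 2) ∧ P (σ 0) (σ 3) ∧
      P (σ 1) (σ 2) ∧ P (σ 1) (σ 3) := by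
  have hn' : ∀ k, P k k → ∃ i j, P i k ∧ P j k ∧ ¬P i j ∧ ¬P j i ∧ i ≠ k ∧ j ≠ k ∧ i ≠ j := by
    intro k hk
    obtain ⟨i, j, hi, hj, hij⟩ := hn k hk
    refine ⟨i, j, hi, hj, hij, fun h => hij (hs _ _ h), ?_, ?_, ?_⟩
    · rintro rfl
      exact hij (hs _ _ hj)
    · rintro rfl
      exact hij hi
    · rintro rfl
      exact hij (hd _ _ hi)
  have hfour : ∀ i j k a b : Fin 4, i ≠ j → i ≠ k → j ≠ k → a ≠ i → b ≠ i → a ≠ j → b ≠ j →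
      a ≠ b → (a = k ∧ b ≠ k) ∨ (b = k ∧ a ≠ k) := by decide
  have huniq : ∀ i j k l m : Fin 4, i ≠ j → i ≠ k → j ≠ k → l ≠ i → l ≠ j → l ≠ k → m ≠ i →
      m ≠ j → m ≠ k → m = l := by decide
  obtain ⟨k, k', hk⟩ := h0
  obtain ⟨i, j, hik, hjk, hij, hji, nik, njk, nij⟩ := hn' k (hd _ _ hk)
  have opp : ∀ i j, P i k → ¬P i j → ¬P j i → i ≠ k → j ≠ k → i ≠ j →
      ∃ l, l ≠ i ∧ l ≠ j ∧ l ≠ k ∧ P i l ∧ ¬P k l := by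
    intro i j hik hij hji nik njk nij
    obtain ⟨a, b, ha, hb, hab, hba, nai, nbi, nab⟩ := hn' i (hd _ _ hik)
    have naj : a ≠ j := by
      rintro rfl
      exact hji ha
    have nbj : b ≠ j := by
      rintro rfl
      exact hji hb
    rcases hfour i j k a b nij nik njk nai nbi naj nbj nab with ⟨rfl, h⟩ | ⟨rfl, h⟩
    · exact ⟨b, nbi, nbj, h, hs _ _ hb, hab⟩
    · exact ⟨a, nai, naj, h, hs _ _ ha, hba⟩
  obtain ⟨l, nli, nlj, nlk, hil, hkl⟩ := opp i j hik hij hji nik njk nij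
  obtain ⟨m, nmj, nmi, nmk, hjm, -⟩ := opp j i hjk hji hij njk nik nij.symm
  obtain rfl := huniq i j k l m nij nik njk nli nlj nlk nmi nmj nmk
  have hinj : Function.Injective ![i, j, k, m] := by
    intro a b
    fin_cases a <;> fin_cases b <;> simp [*, Ne.symm nik, Ne.symm njk, Ne.symm nij, Ne.symm nli,
      Ne.symm nlj, Ne.symm nlk]
  exact ⟨Equiv.ofBijective _ (Finite.injective_iff_bijective.1 hinj), hij, hkl, hik, hil, hjk, hjm⟩

/-- A doubly nonnegative matrix of order four is completely positive. -/
theorem isCompletelyPositive_of_posSemidef_of_nonneg (A : Matrix (Fin 4) (Fin 4) ℝ)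
    (hA : A.PosSemidef) (hpos : ∀ i j, 0 ≤ A i j) : IsCompletelyPositive A := by
  induction h : entriesAddRank A using Nat.strong_induction_on generalizing A with
  | _ N ih =>
  subst h
  have hstep : ∀ x b, A *ᵥ x = b → (∀ i, 0 ≤ b i) → b ≠ 0 →
      (∀ i j, b i ≠ 0 → b j ≠ 0 → A i j ≠ 0) → IsCompletelyPositive A := by
    intro x b hxb hb hb0 hsupp
    obtain ⟨t, ht, h1, h2, h3⟩ := exists_sub_smul_vecMulVec hA hpos x b hxb hb hb0 hsupp
    exact .of_sub_smul_vecMulVec ht hb (ih _ h3 _ h1 h2 rfl)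
  have hs : ∀ i j, A i j = A j i := fun i j => by simpa using (hA.1.apply i j).symm
  have hdiag : ∀ i, A i i = 0 → A *ᵥ Pi.single i 1 = 0 := fun i hi =>
    (hA.dotProduct_mulVec_zero_iff _).1 (by simp [hi])
  by_cases hdet : A.det = 0
  · by_cases h0 : A = 0
    · rw [h0]
      exact isCompletelyPositive_zero
    by_cases hsim : ∃ k, A k k ≠ 0 ∧ ∀ i j, A i k ≠ 0 → A j k ≠ 0 → A i j ≠ 0
    · obtain ⟨k, hk, hkk⟩ := hsim
      refine hstep (Pi.single k 1) (fun i => A i k) ?_ (fun i => hpos i k)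
        (fun h => hk (congrFun h k)) hkk
      ext i
      simp
    · push Not at hsim
      obtain ⟨σ, h01, h23, h02, h03, h12, h13⟩ :=
        exists_perm_cycle_of_no_simplicial (fun i j => A i j ≠ 0)
          (fun i j h => by rwa [hs j i])
          (fun i j h hi => h <| by
            rw [hs]
            simpa using congrFun (hdiag i hi) j)
          (fun k hk => by simpa using hsim k hk)
          (by
            by_contra! h
            exact h0 (Matrix.ext h))
      have hpos' : ∀ {i j}, A i j ≠ 0 → 0 < A i j := fun h => lt_of_le_of_ne (hpos _ _) h.symm
      have hB := isCompletelyPositive_of_cycle (hA.submatrix σ) (not_not.1 h01) (not_not.1 h23)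
        (hpos' h02) (hpos' h03) (hpos' h12) (hpos' h13)
        (by rw [det_submatrix_equiv_self, hdet])
      simpa using hB.submatrix σ.symm
  · refine hstep (A⁻¹ *ᵥ Pi.single 0 1) (Pi.single 0 1) ?_ ?_ ?_ ?_
    · rw [mulVec_mulVec, mul_nonsing_inv _ (isUnit_iff_ne_zero.2 hdet), one_mulVec]
    · intro i
      exact (Pi.single_nonneg (α := fun _ : Fin 4 => ℝ)).2 zero_le_one i
    · simp
    · intro i j hi hj h
      obtain rfl : i = 0 := by
        by_contra hne
        exact hi (Pi.single_eq_of_ne hne _)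
      obtain rfl : j = 0 := by
        by_contra hne
        exact hj (Pi.single_eq_of_ne hne _)
      exact hdet (exists_mulVec_eq_zero_iff.1 ⟨_, by simp, hdiag 0 h⟩)

lemma isDNNOn_of_isCPOn {n : ℕ} {X : Matrix (Fin n) (Fin n) ℝ} {C : Set (Fin n)}
    (h : IsCPOn X C) : IsDNNOn X C := by
  obtain ⟨m, y, hy, hX⟩ := h
  refine ⟨fun i hi j hj => ?_, fun x hx => ?_⟩
  · rw [hX i hi j hj]
    exact Finset.sum_nonneg fun k _ => mul_nonneg (hy k i) (hy k j)
  · have : x ⬝ᵥ X *ᵥ x = ∑ k, (∑ i, y k i * x i) ^ 2 := by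
      simp only [sq, Finset.sum_mul_sum]
      rw [Finset.sum_comm]
      simp only [dotProduct, mulVec, Finset.mul_sum]
      refine Finset.sum_congr rfl fun i _ => ?_
      rw [Finset.sum_comm]
      refine Finset.sum_congr rfl fun j _ => ?_
      by_cases hi : i ∈ C
      · by_cases hj : j ∈ C
        · rw [hX i hi j hj, Finset.sum_mul, Finset.mul_sum]
          exact Finset.sum_congr rfl fun k _ => by ring
        · simp [hx j hj]
      · simp [hx i hi]
    rw [this]
    exact Finset.sum_nonneg fun k _ => sq_nonneg _

lemma isCPOn_of_isDNNOn {n : ℕ} {X : Matrix (Fin n) (Fin n) ℝ} (hX : X.IsSymm)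
    {C : Finset (Fin n)} (hC : C.card ≤ 4) (h : IsDNNOn X C) : IsCPOn X C := by
  rcases C.eq_empty_or_nonempty with rfl | hne
  · exact ⟨0, fun _ _ => 0, fun _ _ => le_rfl, by simp⟩
  obtain ⟨g, hg⟩ : ∃ g : C → Fin 4, Function.Injective g :=
    ⟨fun c => Fin.castLE hC (C.equivFin c),
      (Fin.castLE_injective hC).comp C.equivFin.injective⟩
  have : Nonempty C := hne.to_subtype
  let f : Fin 4 → Fin n := fun a => (Function.invFun g a : C)
  have hfC : ∀ a, f a ∈ C := fun a => (Function.invFun g a).2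
  have hfg : ∀ i (hi : i ∈ C), f (g ⟨i, hi⟩) = i := fun i hi => by
    simp [f, Function.leftInverse_invFun hg ⟨i, hi⟩]
  have hpsd : (X.submatrix f f).PosSemidef := by
    refine PosSemidef.of_dotProduct_mulVec_nonneg ?_ fun x => ?_
    · rw [IsHermitian, conjTranspose_eq_transpose_of_trivial, transpose_submatrix, hX.eq]
    · have h1 := h.2 (fun i => ∑ a, if f a = i then x a else 0) fun i hi =>
        Finset.sum_eq_zero fun a _ => if_neg fun (e : f a = i) => hi (by simpa [← e] using hfC a)
      have hpush : ∀ v : Fin n → ℝ,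
          ∑ i, v i * (∑ a, if f a = i then x a else 0) = ∑ a, v (f a) * x a := fun v => by
        simp only [Finset.mul_sum, mul_ite, mul_zero]
        rw [Finset.sum_comm]
        simp
      rw [dotProduct_comm] at h1
      simp only [dotProduct, mulVec, hpush] at h1
      rw [star_trivial, dotProduct_comm]
      exact h1
  obtain ⟨m, y, hy, hA⟩ := isCompletelyPositive_of_posSemidef_of_nonneg _ hpsd
    fun a b => h.1 _ (hfC a) _ (hfC b)
  classical
  refine ⟨m, fun k i => if hi : i ∈ C then y k (g ⟨i, hi⟩) else 0, fun k i => ?_,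
    fun i hi j hj => ?_⟩
  · dsimp only
    split_ifs
    · exact hy _ _
    · exact le_rfl
  · have hi' : i ∈ C := hi
    have hj' : j ∈ C := hj
    have := hA (g ⟨i, hi'⟩) (g ⟨j, hj'⟩)
    rw [submatrix_apply, hfg, hfg] at this
    simpa [hi', hj'] using this

theorem stmt_13 {n ℓ : ℕ} {ι : Type} [DecidableEq ι] (Ieq Iineq : Finset ι)
    (Q0 : Matrix (Fin (n + 1)) (Fin (n + 1)) ℝ)
    (Q : ι → Matrix (Fin (n + 1)) (Fin (n + 1)) ℝ)
    (G : SimpleGraph (Fin (n + 1)))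
    (hchordal : IsChordal G)
    (C : Fin ℓ → Finset (Fin (n + 1)))
    (hmax : ∀ q, IsMaxClique G (C q : Set (Fin (n + 1))))
    (hall : ∀ s : Finset (Fin (n + 1)), IsMaxClique G (s : Set (Fin (n + 1))) → ∃ q, C q = s)
    (hbc : ∀ q r, q ≠ r → ((C q) ∩ (C r)).card ≤ 1)
    -- aggregated sparsity represented by G
    (hsp0 : ∀ i j, Q0 i j ≠ 0 → i = j ∨ G.Adj i j)
    (hsp : ∀ p ∈ Ieq ∪ Iineq, ∀ i j, Q p i j ≠ 0 → i = j ∨ G.Adj i j)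
    -- every maximal clique has at most 4 nodes
    (hcard : ∀ q, (C q).card ≤ 4) :
    let LC : Matrix (Fin (n + 1)) (Fin (n + 1)) ℝ → Prop := fun X =>
      X 0 0 = 1 ∧ (∀ p ∈ Ieq, trace (Q p * X) = 0) ∧ ∀ p ∈ Iineq, trace (Q p * X) ≤ 0
    let obj : Matrix (Fin (n + 1)) (Fin (n + 1)) ℝ → ℝ := fun X => trace (Q0 * X)
    let FeasCPP := {X : Matrix (Fin (n + 1)) (Fin (n + 1)) ℝ |
      X.IsSymm ∧ (∀ q, IsCPOn X (C q : Set (Fin (n + 1)))) ∧ LC X}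
    let FeasDNN := {X : Matrix (Fin (n + 1)) (Fin (n + 1)) ℝ |
      X.IsSymm ∧ (∀ q, IsDNNOn X (C q : Set (Fin (n + 1)))) ∧ LC X}
    -- same feasible solutions, hence same optimal solutions and optimal value
    FeasCPP = FeasDNN ∧ sInf (obj '' FeasCPP) = sInf (obj '' FeasDNN) := by
  intro LC obj FeasCPP FeasDNN
  have hfeas : FeasCPP = FeasDNN := by
    ext X
    refine and_congr_right fun hX => and_congr_left fun _ => forall_congr' fun q => ?_
    exact ⟨isDNNOn_of_isCPOn, isCPOn_of_isDNNOn hX (hcard q)⟩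
  exact ⟨hfeas, by rw [hfeas]⟩
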